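/- Let p ∈ ℂ[x] be nonzero with n = deg p and c ∈ ℂ such that p(x) = (−1)^n p(−x + c). Let 𝔭 = ⊕_{j∈ℤ} 𝔭_j be a ℤ-graded Lie subalgebra of 𝒟_p^± (i.e., 𝔭_j ⊆ (𝒟_p^±)_j for all j and 𝔭 is closed under the bracket) with 𝔭_0 = (𝒟_p^±)_0. If 𝔭_j ≠ 0, then 𝔭_j has finite codimension in the ℂ-vector space (𝒟_p^±)_j. -/

import Mathlib

noncomputable section

/-- ℂ[t,t⁻¹] as a ℂ-vector space with basis {t^j}_{j∈ℤ}; t^j is `Finsupp.single j 1`. -/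
abbrev LaurentV : Type := ℤ →₀ ℂ

/-- The regular differential operator `t^k f(D)` (where D = t·d/dt), acting by
t^j ↦ f(j)·t^{j+k}. -/
def op (k : ℤ) (f : Polynomial ℂ) : Module.End ℂ LaurentV :=
  Finsupp.lsum ℂ fun j => f.eval (j : ℂ) • Finsupp.lsingle (j + k)

/-- The graded piece (𝒟ᵃ_p)_j = {t^j f(D) p(D) : f ∈ ℂ[x]}. -/
def Dgrade (p : Polynomial ℂ) (j : ℤ) : Submodule ℂ (Module.End ℂ LaurentV) :=
  Submodule.span ℂ {A | ∃ f : Polynomial ℂ, A = op j (f * p)}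

/-- 𝒟ᵃ_p = 𝒟ᵃ·p(D). -/
def Dp (p : Polynomial ℂ) : Submodule ℂ (Module.End ℂ LaurentV) :=
  Submodule.span ℂ {A | ∃ (k : ℤ) (f : Polynomial ℂ), A = op k (f * p)}

/-- σ is an anti-involution: it is ℂ-linear (built into the type), involutive, and
reverses products. -/
def IsAntiInvolutionOn (p : Polynomial ℂ) (σ : ↥(Dp p) →ₗ[ℂ] ↥(Dp p)) : Prop :=
  (∀ A : ↥(Dp p), σ (σ A) = A) ∧
  (∀ A B W : ↥(Dp p),
    (W : Module.End ℂ LaurentV) = (A : Module.End ℂ LaurentV) * (B : Module.End ℂ LaurentV) →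
    ((σ W : Module.End ℂ LaurentV)) = (σ B : Module.End ℂ LaurentV) * (σ A : Module.End ℂ LaurentV))

/-- σ preserves the principal ℤ-gradation. -/
def PreservesGrading (p : Polynomial ℂ) (σ : ↥(Dp p) →ₗ[ℂ] ↥(Dp p)) : Prop :=
  ∀ (j : ℤ) (A : ↥(Dp p)), (A : Module.End ℂ LaurentV) ∈ Dgrade p j →
    ((σ A : Module.End ℂ LaurentV)) ∈ Dgrade p j

/-- σ(t^k f(D) p(D)) = (-1)^{deg p}·e^k·t^k f(−D−k+c)p(D). -/
def SigmaFormula (p : Polynomial ℂ) (c e : ℂ) (σ : ↥(Dp p) →ₗ[ℂ] ↥(Dp p)) : Prop :=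
  ∀ (k : ℤ) (f : Polynomial ℂ) (A : ↥(Dp p)), (A : Module.End ℂ LaurentV) = op k (f * p) →
    ((σ A : Module.End ℂ LaurentV)) =
      ((-1 : ℂ) ^ p.natDegree * e ^ k) •
        op k ((f.comp (Polynomial.C (c - (k : ℂ)) - Polynomial.X)) * p)

/-- The graded piece (𝒟_p^±)_k = {d ∈ (𝒟_p)_k : σ_±(d) = −d}, as a set. -/
def DpmGradeSet (p : Polynomial ℂ) (c e : ℂ) (k : ℤ) : Set (Module.End ℂ LaurentV) :=
  {A | ∃ f : Polynomial ℂ, A = op k (f * p) ∧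
    ((-1 : ℂ) ^ p.natDegree * e ^ k) •
      op k ((f.comp (Polynomial.C (c - (k : ℂ)) - Polynomial.X)) * p) = -A}

/-- The graded piece (𝒟_p^±)_k, as a ℂ-subspace. -/
def DpmGrade (p : Polynomial ℂ) (c e : ℂ) (k : ℤ) : Submodule ℂ (Module.End ℂ LaurentV) :=
  Submodule.span ℂ (DpmGradeSet p c e k)

/-- V has finite codimension in W. -/
def FinCodimIn {M : Type*} [AddCommGroup M] [Module ℂ M] (V W : Submodule ℂ M) : Prop :=
  FiniteDimensional ℂ (↥W ⧸ Submodule.comap W.subtype V)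

open Polynomial

theorem op_single (k : ℤ) (f : Polynomial ℂ) (i : ℤ) :
    op k f (Finsupp.single i 1) = Finsupp.single (i + k) (f.eval (i : ℂ)) := by
  simp [op]

/-- `f ↦ t^k f(D)` as a linear map. -/
def opLinear (k : ℤ) : Polynomial ℂ →ₗ[ℂ] Module.End ℂ LaurentV where
  toFun := op k
  map_add' f g := by
    ext i : 2
    simp [op_single]
  map_smul' a f := by
    ext i : 2
    simp [op_single]

theorem opLinear_apply (k : ℤ) (f : Polynomial ℂ) : opLinear k f = op k f := rfl

theorem op_injective (k : ℤ) : Function.Injective (op k) := by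
  intro f g h
  refine eq_of_infinite_eval_eq f g
    ((Set.infinite_range_of_injective (Int.cast_injective (α := ℂ))).mono ?_)
  rintro _ ⟨i, rfl⟩
  have h' := congrArg (fun A : Module.End ℂ LaurentV => A (Finsupp.single i 1)) h
  simp only [op_single] at h'
  exact Finsupp.single_injective _ h'

theorem lie_op_zero_op (j : ℤ) (h f : Polynomial ℂ) :
    ⁅op 0 h, op j f⁆ = op j ((taylor (j : ℂ) h - h) * f) := by
  have hs (k : ℤ) (u : Polynomial ℂ) (i : ℤ) (a : ℂ) :
      op k u (Finsupp.single i a) = Finsupp.single (i + k) (u.eval (i : ℂ) * a) := by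
    simp [op]
  ext i : 2
  simp only [LinearMap.coe_comp, Function.comp_apply, Finsupp.lsingle_apply, Ring.lie_def,
    LinearMap.sub_apply, Module.End.mul_apply, hs, add_zero, mul_one]
  rw [← Finsupp.single_sub]
  congr 1
  simp only [taylor_apply, eval_mul, eval_sub, eval_comp, eval_add, eval_X, eval_C]
  push_cast
  ring

/-- `f ↦ t^k f(D) p(D)` as a linear map. -/
def opMul (p : Polynomial ℂ) (k : ℤ) : Polynomial ℂ →ₗ[ℂ] Module.End ℂ LaurentV :=
  opLinear k ∘ₗ LinearMap.mulRight ℂ p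

theorem opMul_apply (p : Polynomial ℂ) (k : ℤ) (f : Polynomial ℂ) :
    opMul p k f = op k (f * p) := rfl

theorem opMul_injective {p : Polynomial ℂ} (hp : p ≠ 0) (k : ℤ) :
    Function.Injective (opMul p k) := fun _ _ h =>
  mul_right_cancel₀ hp (op_injective k h)

/-- The polynomials `f` with `ε f(a - x) = -f(x)`. -/
def reflectionSubmodule (ε a : ℂ) : Submodule ℂ (Polynomial ℂ) where
  carrier := {f | ε • f.comp (C a - X) = -f}
  zero_mem' := by simp
  add_mem' {f g} hf hg := by
    simp only [Set.mem_ofPred_eq] at *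
    rw [add_comp, smul_add, hf, hg]; ring
  smul_mem' b f hf := by
    simp only [Set.mem_ofPred_eq] at *
    rw [smul_comp, smul_comm, hf, smul_neg]

theorem mem_reflectionSubmodule {ε a : ℂ} {f : Polynomial ℂ} :
    f ∈ reflectionSubmodule ε a ↔ ε • f.comp (C a - X) = -f := Iff.rfl

theorem C_sub_X_eq (a : ℂ) : (C a - X : Polynomial ℂ) = C (-1) * X + C a := by
  simp only [C_neg, C_1]; ring

theorem mul_neg_one_pow_natDegree_of_mem {ε a : ℂ} {f : Polynomial ℂ}
    (hf : f ∈ reflectionSubmodule ε a) (hf0 : f ≠ 0) : ε * (-1) ^ f.natDegree = -1 := by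
  have hd : (C a - X : Polynomial ℂ).natDegree = 1 := by
    rw [C_sub_X_eq]; exact natDegree_linear (by norm_num)
  have hl : (C a - X : Polynomial ℂ).leadingCoeff = -1 := by
    rw [C_sub_X_eq]; exact leadingCoeff_linear (by norm_num)
  have h := congrArg leadingCoeff (mem_reflectionSubmodule.1 hf)
  rw [leadingCoeff_neg, smul_eq_C_mul, leadingCoeff_mul, leadingCoeff_C,
    leadingCoeff_comp (by rw [hd]; norm_num), hl] at h
  apply mul_right_cancel₀ (leadingCoeff_ne_zero.2 hf0)
  linear_combination h

theorem dpmGrade_le_map (p : Polynomial ℂ) (hp : p ≠ 0) (c e : ℂ) (k : ℤ) :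
    DpmGrade p c e k ≤
      (reflectionSubmodule ((-1) ^ p.natDegree * e ^ k) (c - k)).map (opMul p k) := by
  refine Submodule.span_le.2 ?_
  rintro A ⟨f, rfl, hf⟩
  refine ⟨f, opMul_injective hp k ?_, rfl⟩
  rw [map_smul, map_neg]
  exact hf

theorem degree_taylor_sub_self {r : ℂ} (hr : r ≠ 0) {h : Polynomial ℂ} {d : ℕ}
    (hd : h.natDegree = d + 1) : (taylor r h - h).degree = d := by
  have hh : h ≠ 0 := by rintro rfl; simp at hd
  have hlt : (taylor r h - h).natDegree < d + 1 := by
    have h1 : (taylor r h - h).degree < (taylor r h).degree := by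
      refine degree_sub_lt_left ?_ ?_ ?_
      · exact degree_taylor h r
      · simpa using hh
      · exact leadingCoeff_taylor r h
    rw [degree_taylor, degree_eq_natDegree hh, hd] at h1
    by_cases h0 : taylor r h - h = 0
    · rw [h0]; simp
    · exact (natDegree_lt_iff_degree_lt h0).2 h1
  refine degree_eq_of_le_of_coeff_ne_zero (natDegree_le_iff_degree_le.1 (by omega)) ?_
  have hb : (hasseDeriv d h).natDegree ≤ 1 := by
    have := natDegree_hasseDeriv_le h d
    omega
  rw [coeff_sub, taylor_coeff, eval_eq_sum_range' (n := 2) (by omega)]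
  simp only [Finset.sum_range_succ, Finset.sum_range_zero, hasseDeriv_coeff]
  have hl : h.coeff (1 + d) ≠ 0 := by
    rw [add_comm, ← hd]; exact leadingCoeff_ne_zero.2 hh
  have hd1 : (d : ℂ) + 1 ≠ 0 := by exact_mod_cast Nat.succ_ne_zero d
  have hch : (((1 + d).choose d : ℕ) : ℂ) = d + 1 := by
    rw [add_comm, Nat.choose_succ_self_right]; push_cast; ring
  simp only [hch]
  simpa using ⟨⟨hd1, hl⟩, hr⟩

theorem finCodimIn_of_le_sup {M : Type*} [AddCommGroup M] [Module ℂ M]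
    {V W F : Submodule ℂ M} [FiniteDimensional ℂ F] (h : W ≤ V ⊔ F) : FinCodimIn V W := by
  have hker : LinearMap.ker (V.mkQ ∘ₗ W.subtype) = Submodule.comap W.subtype V := by
    rw [LinearMap.ker_comp, Submodule.ker_mkQ]
  have hr : LinearMap.range (V.mkQ ∘ₗ W.subtype) ≤ F.map V.mkQ := by
    rw [LinearMap.range_comp, Submodule.range_subtype]
    refine (Submodule.map_mono h).trans ?_
    rw [Submodule.map_sup, Submodule.mkQ_map_self, bot_sup_eq]
  have : FiniteDimensional ℂ (LinearMap.range (V.mkQ ∘ₗ W.subtype)) :=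
    Submodule.finiteDimensional_of_le hr
  rw [FinCodimIn, ← hker]
  exact Module.Finite.equiv (LinearMap.quotKerEquivRange _).symm

/-- A subspace `U` that reaches every degree `≥ N` occurring in `W` contains `W` up to polynomials
of degree `< N`. -/
theorem le_sup_degreeLT {U W : Submodule ℂ (Polynomial ℂ)} {N : ℕ} (hUW : U ≤ W)
    (h : ∀ f ∈ W, f ≠ 0 → N ≤ f.natDegree → ∃ v ∈ U, v ≠ 0 ∧ v.natDegree = f.natDegree) :
    W ≤ U ⊔ degreeLT ℂ N := by
  suffices H : ∀ (d : ℕ) (f : Polynomial ℂ), f ∈ W → f.degree < d → f ∈ U ⊔ degreeLT ℂ N by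
    intro f hf
    exact H (f.natDegree + 1) f hf
      (degree_le_natDegree.trans_lt (by exact_mod_cast Nat.lt_succ_self _))
  intro d
  induction d with
  | zero =>
    intro f _ hd
    have : f = 0 := by
      rw [← degree_eq_bot]; simpa using hd
    rw [this]; exact zero_mem _
  | succ d ih =>
    intro f hf hd
    by_cases hf0 : f = 0
    · rw [hf0]; exact zero_mem _
    by_cases hN : N ≤ f.natDegree
    · obtain ⟨v, hv, hv0, hvd⟩ := h f hf hf0 hN
      have hlv := leadingCoeff_ne_zero.2 hv0
      have hlf := leadingCoeff_ne_zero.2 hf0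
      set a := f.leadingCoeff / v.leadingCoeff with ha
      have ha0 : a ≠ 0 := div_ne_zero hlf hlv
      have hlt : (f - a • v).degree < f.degree := by
        refine degree_sub_lt_left ?_ hf0 ?_
        · rw [degree_smul_of_smul_regular _ (IsSMulRegular.of_ne_zero ha0),
            degree_eq_natDegree hf0, degree_eq_natDegree hv0, hvd]
        · rw [smul_eq_C_mul, leadingCoeff_mul, leadingCoeff_C, ha, div_mul_cancel₀ _ hlv]
      have hle : f.degree ≤ d := by
        rw [degree_eq_natDegree hf0] at hd ⊢
        exact_mod_cast Nat.lt_succ_iff.1 (by exact_mod_cast hd)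
      have hmem := ih (f - a • v) (W.sub_mem hf (W.smul_mem a (hUW hv))) (hlt.trans_le hle)
      have := add_mem hmem (Submodule.mem_sup_left (T := degreeLT ℂ N) (U.smul_mem a hv))
      simpa using this
    · refine Submodule.mem_sup_right (mem_degreeLT.2 ?_)
      rw [degree_eq_natDegree hf0]
      exact_mod_cast not_le.1 hN

theorem X_sub_C_pow_comp (c : ℂ) (m : ℕ) :
    ((X - C (c / 2)) ^ m : Polynomial ℂ).comp (C c - X) = (-1) ^ m * (X - C (c / 2)) ^ m := by
  rw [pow_comp, ← mul_pow]
  congr 1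
  have : (C c : Polynomial ℂ) = C (c / 2) + C (c / 2) := by rw [← C_add]; congr 1; ring
  simp only [sub_comp, X_comp, C_comp, this]
  ring

theorem op_zero_mem_dpmGrade (p : Polynomial ℂ) (c e : ℂ) {m : ℕ} (hm : Odd (p.natDegree + m)) :
    op 0 ((X - C (c / 2)) ^ m * p) ∈ DpmGrade p c e 0 := by
  refine Submodule.subset_span ⟨_, rfl, ?_⟩
  have hs : ((-1 : ℂ) ^ p.natDegree * e ^ (0 : ℤ)) •
      (((X - C (c / 2)) ^ m : Polynomial ℂ).comp (C (c - ((0 : ℤ) : ℂ)) - X) * p)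
        = -((X - C (c / 2)) ^ m * p) := by
    have h1 : (-1 : Polynomial ℂ) ^ p.natDegree * (-1) ^ m = -1 := by
      rw [← pow_add, hm.neg_one_pow]
    rw [Int.cast_zero, sub_zero, X_sub_C_pow_comp, zpow_zero, mul_one, smul_eq_C_mul, C_pow,
      C_neg, C_1]
    linear_combination ((X - C (c / 2)) ^ m * p) * h1
  rw [← opLinear_apply, ← opLinear_apply, ← map_smul, hs]
  exact map_neg (opLinear 0) _

theorem graded_subalgebra_finite_codim (p : Polynomial ℂ) (hp : p ≠ 0) (c : ℂ)
    (hpc : ∀ x : ℂ, p.eval x = (-1 : ℂ) ^ p.natDegree * p.eval (-x + c))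
    (e : ℂ) (he : e = 1 ∨ e = -1)
    (𝔭 : ℤ → Submodule ℂ (Module.End ℂ LaurentV))
    (hsub : ∀ j : ℤ, 𝔭 j ≤ DpmGrade p c e j)
    (hbrk : ∀ (i j : ℤ) (x y : Module.End ℂ LaurentV),
      x ∈ 𝔭 i → y ∈ 𝔭 j → ⁅x, y⁆ ∈ 𝔭 (i + j))
    (h0 : 𝔭 0 = DpmGrade p c e 0) :
    ∀ j : ℤ, 𝔭 j ≠ ⊥ → FinCodimIn (M := Module.End ℂ LaurentV) (𝔭 j) (DpmGrade p c e j) := by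
  intro j hj
  rcases eq_or_ne j 0 with rfl | hj0
  · exact finCodimIn_of_le_sup (F := ⊥) (h0 ▸ le_sup_left)
  set W := reflectionSubmodule ((-1) ^ p.natDegree * e ^ j) (c - j)
  have hle : 𝔭 j ≤ W.map (opMul p j) := (hsub j).trans (dpmGrade_le_map p hp c e j)
  set U := (𝔭 j).comap (opMul p j)
  have hUW : U ≤ W := fun f hf => by
    obtain ⟨g, hg, hgf⟩ := hle hf
    rwa [← opMul_injective hp j hgf]
  obtain ⟨A, hA, hA0⟩ := Submodule.exists_mem_ne_zero_of_ne_bot hj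
  obtain ⟨f₀, hf₀W, rfl⟩ := hle hA
  have hf₀ : f₀ ≠ 0 := by rintro rfl; exact hA0 (map_zero _)
  have hWU : W ≤ U ⊔ degreeLT ℂ (f₀.natDegree + p.natDegree) := by
    refine le_sup_degreeLT hUW fun f hf hf0 hN => ?_
    obtain ⟨m, hm⟩ := Nat.exists_eq_add_of_le hN
    have hpar : Odd (p.natDegree + (m + 1)) := by
      have h1 := mul_neg_one_pow_natDegree_of_mem hf hf0
      have h2 := mul_neg_one_pow_natDegree_of_mem hf₀W hf₀
      rw [hm, add_assoc, pow_add, ← mul_assoc, h2] at h1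
      have h3 : (-1 : ℂ) ^ (p.natDegree + m) = 1 := by linear_combination -h1
      rw [← add_assoc]
      exact (neg_one_pow_eq_one_iff_even (by norm_num)).1 h3 |>.add_one
    set h := (X - C (c / 2)) ^ (m + 1) * p with hh
    have hmon : ((X - C (c / 2)) ^ (m + 1) : Polynomial ℂ).Monic := (monic_X_sub_C _).pow _
    have hhd : h.natDegree = (p.natDegree + m) + 1 := by
      rw [hh, natDegree_mul hmon.ne_zero hp, natDegree_pow, natDegree_X_sub_C]; ring
    have hqd := degree_taylor_sub_self (r := (j : ℂ)) (by exact_mod_cast hj0) hhd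
    have hq0 : taylor (j : ℂ) h - h ≠ 0 := by
      intro hq
      rw [hq, degree_zero] at hqd
      exact WithBot.bot_ne_coe hqd
    refine ⟨(taylor (j : ℂ) h - h) * f₀, ?_, mul_ne_zero hq0 hf₀, ?_⟩
    · have hb := hbrk 0 j (op 0 h) (opMul p j f₀)
        (by rw [h0]; exact op_zero_mem_dpmGrade p c e hpar) hA
      rw [opMul_apply, lie_op_zero_op, zero_add, ← mul_assoc] at hb
      exact hb
    · rw [natDegree_mul hq0 hf₀, natDegree_eq_of_degree_eq_some hqd, hm]; ring
  have : FiniteDimensional ℂ (degreeLT ℂ (f₀.natDegree + p.natDegree)) :=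
    Module.Finite.equiv (degreeLTEquiv ℂ _).symm
  refine finCodimIn_of_le_sup
    (F := (degreeLT ℂ (f₀.natDegree + p.natDegree)).map (opMul p j)) ?_
  refine (dpmGrade_le_map p hp c e j).trans ((Submodule.map_mono hWU).trans ?_)
  rw [Submodule.map_sup]
  exact sup_le_sup_right (Submodule.map_comap_le _ _) _

end
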